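/- For every fixed t ∈ ℝ, the function z ↦ 𝔖_t(z), restricted to the real line, belongs to L²(ℝ) (with respect to Lebesgue measure). Moreover, its L²(ℝ)-norm is uniformly bounded for t ranging over any compact subset of ℝ. -/

import Mathlib

open MeasureTheory Real Complex Filter Set
open scoped Topology

noncomputable section

/-- The von Mangoldt function. -/
def vM (n : ℕ) : ℝ := ArithmeticFunction.vonMangoldt n

/-- The logarithmic derivative `Γ'/Γ` of the complex Gamma function. -/
def digamma (s : ℂ) : ℂ := deriv Complex.Gamma s / Complex.Gamma s

/-- The logarithmic derivative `Γ'/Γ` of the real Gamma function. -/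
def digammaR (x : ℝ) : ℝ := deriv Real.Gamma x / Real.Gamma x

/-- The Hurwitz–Lerch zeta function `Φ(z,s,a) = ∑_{n≥0} z^n (n+a)^{-s}`, real version. -/
def PhiR (z s a : ℝ) : ℝ := ∑' n : ℕ, z ^ n / ((n : ℝ) + a) ^ s

/-- The Hurwitz–Lerch zeta function `Φ(z,s,a) = ∑_{n≥0} z^n (n+a)^{-s}`, complex version. -/
def PhiC (z s a : ℂ) : ℂ := ∑' n : ℕ, z ^ n / ((n : ℂ) + a) ^ s

/-- The screw function `g(t)`, extended evenly to all of `ℝ`. -/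
def g (t : ℝ) : ℝ :=
  -4 * (Real.exp (|t| / 2) + Real.exp (-|t| / 2) - 2)
    - |t| / 2 * (digammaR (1 / 4) - Real.log π)
    - (1 / 4) * (PhiR 1 2 (1 / 4) - Real.exp (-|t| / 2) * PhiR (Real.exp (-2 * |t|)) 2 (1 / 4))
    + ∑ n ∈ Finset.Icc 1 ⌊Real.exp |t|⌋₊, vM n / Real.sqrt n * (|t| - Real.log n)

/-- `Z(s) = π^{-s/2} Γ(s/2) ζ(s)`. -/
def Zfun (s : ℂ) : ℂ := (π : ℂ) ^ (-s / 2) * Complex.Gamma (s / 2) * riemannZeta s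

/-- The function `𝔓_t(z)` (for `t ≥ 0`). -/
def Pfrak (t : ℝ) (z : ℂ) : ℂ :=
  4 * ((Real.exp (t / 2) : ℂ) - 1) / (1 - 2 * I * z)
    + 4 * ((Real.exp (-t / 2) : ℂ) - 1) / (1 + 2 * I * z)
    - ∑ n ∈ Finset.Icc 1 ⌊Real.exp t⌋₊,
        ((vM n / Real.sqrt n : ℝ) : ℂ) *
          ((Complex.exp (I * z * ((t : ℝ) - Real.log n)) - 1) / (I * z))
    + (Complex.exp (I * t * z) - 1) / (I * z) *
        (deriv Zfun (1 / 2 - I * z) / Zfun (1 / 2 - I * z) - (1 / 2) * (Real.log π : ℂ)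
          + (1 / 2) * _root_.digamma (1 / 4 + I * z / 2))
    - 1 / (2 * I * z) * (_root_.digamma (1 / 4) - _root_.digamma (1 / 4 + I * z / 2))
    - 1 / (2 * I * z) * (Real.exp (-t / 2) : ℂ) *
        (PhiC (Real.exp (-2 * t)) 1 (1 / 4) - PhiC (Real.exp (-2 * t)) 1 ((1 / 2 + I * z) / 2))

/-- The Riemann xi function `ξ(s) = (1/2)s(s-1)π^{-s/2}Γ(s/2)ζ(s)`. -/
def xi (s : ℂ) : ℂ := s * (s - 1) / 2 * (π : ℂ) ^ (-s / 2) * Complex.Gamma (s / 2) * riemannZeta s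

/-- `E(z) = ξ(1/2-iz) + ξ'(1/2-iz)`. -/
def Efun (z : ℂ) : ℂ := xi (1 / 2 - I * z) + deriv xi (1 / 2 - I * z)

/-- `Θ(z) = conj(E(conj z)) / E(z)`. -/
def Theta (z : ℂ) : ℂ := (starRingEnd ℂ) (Efun ((starRingEnd ℂ) z)) / Efun z

/-- The screw line `𝔖_t(z)`, extended to negative `t` by `𝔖_{-t} = 𝔖_t`. -/
def Sfrak (t : ℝ) (z : ℂ) : ℂ := I * (1 + Theta z) / (2 * (Real.sqrt π : ℂ)) * Pfrak |t| z

/-- The entire function `z ↦ ξ(1/2 - iz)`. -/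
def xiShift (z : ℂ) : ℂ := xi (1 / 2 - I * z)

/-- The set of zeros of `z ↦ ξ(1/2 - iz)` (not counting multiplicity). -/
def XiZeros : Set ℂ := {z | xiShift z = 0}

/-- The multiplicity of a zero of `z ↦ ξ(1/2 - iz)`. -/
def mult (γ : ℂ) : ℕ := sInf {n : ℕ | iteratedDeriv n xiShift γ ≠ 0}

/-- The kernel `G_g(t,u) = g(t-u) - g(t) - g(u) + g(0)`. -/
def Gg (t u : ℝ) : ℝ := g (t - u) - g t - g u + g 0

/-- `𝒫̂_φ(z) = ∫_ℝ 𝔖_t(z) φ(t) dt`. -/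
def Phat (φ : ℝ → ℂ) (z : ℂ) : ℂ := ∫ t : ℝ, Sfrak t z * φ t

/-- The Fourier-type transform `φ̂(z) = ∫_ℝ φ(t) e^{izt} dt`. -/
def FT (φ : ℝ → ℂ) (z : ℂ) : ℂ := ∫ t : ℝ, φ t * Complex.exp (I * z * t)

lemma norm_inv_sub_inv_le {c R : ℝ} (hc : 0 < c) (hc1 : c ≤ 1) {s : ℂ} (hs : c < s.re)
    (hR : ‖s‖ < R) (n : ℕ) :
    ‖((n : ℂ) + 1)⁻¹ - (s + n)⁻¹‖ ≤ (R + 1) / c * (1 / ((n : ℝ) + 1) ^ 2) := by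
  have h1 : ((n : ℂ) + 1) ≠ 0 := Nat.cast_add_one_ne_zero n
  have hn : (0 : ℝ) ≤ n := n.cast_nonneg
  have h2 : c * ((n : ℝ) + 1) ≤ ‖s + n‖ := by
    have : (s + n).re ≤ ‖s + n‖ := Complex.re_le_norm _
    simp only [Complex.add_re, Complex.natCast_re] at this
    nlinarith
  have h3 : 0 < ‖s + n‖ := lt_of_lt_of_le (by positivity) h2
  rw [inv_sub_inv h1 (norm_pos_iff.mp h3), norm_div, norm_mul]
  have h4 : ‖s + n - (n + 1)‖ ≤ R + 1 := by
    calc ‖s + n - (n + 1)‖ = ‖s - 1‖ := by ring_nf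
      _ ≤ ‖s‖ + ‖(1 : ℂ)‖ := norm_sub_le _ _
      _ ≤ R + 1 := by rw [norm_one]; linarith
  have h5 : ‖(n : ℂ) + 1‖ = n + 1 := by
    exact_mod_cast Complex.norm_natCast (n + 1)
  rw [h5]
  calc _ ≤ (R + 1) / (((n : ℝ) + 1) * (c * ((n : ℝ) + 1))) := by
        gcongr
        exact (norm_nonneg _).trans h4
    _ = _ := by field_simp

lemma tendsto_sum_inv_sub_log :
    Tendsto (fun N : ℕ => ∑ n ∈ Finset.range (N + 1), ((n : ℂ) + 1)⁻¹ - (Real.log N : ℂ)) atTop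
      (𝓝 (Real.eulerMascheroniConstant : ℂ)) := by
  have h1 : Tendsto (fun N : ℕ => ((harmonic N : ℝ) - Real.log N) + 1 / ((N : ℝ) + 1)) atTop
      (𝓝 (Real.eulerMascheroniConstant + 0)) :=
    Real.tendsto_harmonic_sub_log.add tendsto_one_div_add_atTop_nhds_zero_nat
  rw [add_zero] at h1
  refine ((Complex.continuous_ofReal.tendsto _).comp h1).congr fun N => ?_
  simp only [Function.comp, harmonic, Finset.sum_range_succ]
  push_cast
  ring

/-- The factors of the Weierstrass product of the Gamma function, in logarithmic form. -/
def logGammaTerm (n : ℕ) (s : ℂ) : ℂ :=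
  (s - 1) * ((n : ℂ) + 1)⁻¹ - Complex.log (s + n) + Complex.log (n + 1)

lemma add_natCast_mem_slitPlane {s : ℂ} (hs : 0 < s.re) (n : ℕ) : s + n ∈ slitPlane :=
  Or.inl (by simpa using by positivity)

lemma hasDerivAt_logGammaTerm (n : ℕ) {s : ℂ} (hs : 0 < s.re) :
    HasDerivAt (logGammaTerm n) (((n : ℂ) + 1)⁻¹ - (s + n)⁻¹) s := by
  have h1 := ((hasDerivAt_id s).sub_const 1).mul_const ((n : ℂ) + 1)⁻¹
  have h2 := ((hasDerivAt_id s).add_const (n : ℂ)).clog (add_natCast_mem_slitPlane hs n)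
  exact ((h1.sub h2).add_const (Complex.log (n + 1))).congr_deriv (by simp)

lemma exp_sum_logGammaTerm {s : ℂ} (hs : 0 < s.re) {N : ℕ} (hN : N ≠ 0) :
    Complex.exp (∑ n ∈ Finset.range (N + 1), logGammaTerm n s) =
      Complex.exp ((s - 1) * (∑ n ∈ Finset.range (N + 1), ((n : ℂ) + 1)⁻¹ - (Real.log N : ℂ))) *
        (Complex.GammaSeq s N / Complex.GammaSeq 1 N) := by
  have hN' : (N : ℂ) ≠ 0 := Nat.cast_ne_zero.mpr hN
  have hs' : ∀ n : ℕ, s + n ≠ 0 := fun n => slitPlane_ne_zero (add_natCast_mem_slitPlane hs n)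
  have h1' : ∀ n : ℕ, (1 : ℂ) + n ≠ 0 := fun n => by rw [add_comm]; exact Nat.cast_add_one_ne_zero n
  have hP : ∏ n ∈ Finset.range (N + 1), (s + n) ≠ 0 := Finset.prod_ne_zero_iff.mpr fun n _ => hs' n
  have hQ : ∏ n ∈ Finset.range (N + 1), (1 + (n : ℂ)) ≠ 0 :=
    Finset.prod_ne_zero_iff.mpr fun n _ => h1' n
  have hterm : ∀ n : ℕ, Complex.exp (logGammaTerm n s) =
      Complex.exp ((s - 1) * ((n : ℂ) + 1)⁻¹) * ((1 + (n : ℂ)) / (s + n)) := fun n => by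
    rw [logGammaTerm, Complex.exp_add, Complex.exp_sub, Complex.exp_log (hs' n),
      Complex.exp_log (Nat.cast_add_one_ne_zero n)]
    ring
  have hlog : (Real.log N : ℂ) = Complex.log N := by simp
  have hpow : (N : ℂ) ^ s = N * Complex.exp ((s - 1) * Complex.log N) := by
    rw [Complex.cpow_def_of_ne_zero hN', sub_mul, one_mul, Complex.exp_sub, Complex.exp_log hN',
      mul_comm s]
    field_simp
  rw [Complex.exp_sum, Finset.prod_congr rfl fun n _ => hterm n, Finset.prod_mul_distrib,
    ← Complex.exp_sum, ← Finset.mul_sum, Finset.prod_div_distrib, mul_sub, Complex.exp_sub,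
    Complex.GammaSeq, Complex.GammaSeq, hlog, hpow, Complex.cpow_one]
  have hf : (N.factorial : ℂ) ≠ 0 := Nat.cast_ne_zero.mpr N.factorial_ne_zero
  have he := Complex.exp_ne_zero ((s - 1) * Complex.log N)
  field_simp

lemma summable_one_div_add_one_sq : Summable fun n : ℕ => 1 / ((n : ℝ) + 1) ^ 2 := by
  exact_mod_cast (summable_nat_add_iff 1).mpr (Real.summable_one_div_nat_pow.mpr one_lt_two)

/-- The series expansion of the digamma function on the right half-plane. -/
lemma hasSum_digamma {s : ℂ} (hs : 0 < s.re) :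
    HasSum (fun n : ℕ => ((n : ℂ) + 1)⁻¹ - (s + n)⁻¹)
      (_root_.digamma s + Real.eulerMascheroniConstant) := by
  obtain ⟨c, hc, hc1, hcs⟩ : ∃ c : ℝ, 0 < c ∧ c < 1 ∧ c < s.re :=
    ⟨min 1 s.re / 2, by positivity, by linarith [min_le_left 1 s.re],
      by linarith [min_le_right 1 s.re]⟩
  set R : ℝ := ‖s‖ + 2 with hR
  set U : Set ℂ := {w | c < w.re} ∩ Metric.ball 0 R with hU
  have hUo : IsOpen U := (isOpen_lt continuous_const Complex.continuous_re).inter Metric.isOpen_ball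
  have hUc : IsPreconnected U :=
    ((convex_halfSpace_re_gt c).inter (convex_ball 0 R)).isPreconnected
  have hsU : s ∈ U := ⟨hcs, by simp [hR]⟩
  have h1U : (1 : ℂ) ∈ U := ⟨by simpa using hc1, by simp [hR]; linarith [norm_nonneg s]⟩
  have hpos : ∀ w ∈ U, 0 < w.re := fun w hw => hc.trans hw.1
  have hu : Summable fun n : ℕ => (R + 1) / c * (1 / ((n : ℝ) + 1) ^ 2) :=
    summable_one_div_add_one_sq.mul_left _
  have hbound : ∀ (n : ℕ) (w : ℂ), w ∈ U →
      ‖((n : ℂ) + 1)⁻¹ - (w + n)⁻¹‖ ≤ (R + 1) / c * (1 / ((n : ℝ) + 1) ^ 2) := fun n w hw =>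
    norm_inv_sub_inv_le hc hc1.le hw.1 (by simpa using hw.2) n
  have hder : ∀ (n : ℕ) (w : ℂ), w ∈ U →
      HasDerivAt (logGammaTerm n) (((n : ℂ) + 1)⁻¹ - (w + n)⁻¹) w := fun n w hw =>
    hasDerivAt_logGammaTerm n (hpos w hw)
  have h0 : Summable fun n : ℕ => logGammaTerm n 1 := by
    have : (fun n : ℕ => logGammaTerm n 1) = 0 := by
      ext n
      simp [logGammaTerm, add_comm]
    rw [this]
    exact summable_zero
  have hG : ∀ w ∈ U, HasDerivAt (fun w => ∑' n : ℕ, logGammaTerm n w)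
      (∑' n : ℕ, (((n : ℂ) + 1)⁻¹ - (w + n)⁻¹)) w := fun w hw =>
    hasDerivAt_tsum_of_isPreconnected hu hUo hUc hder hbound h1U h0 hw
  have hsum : ∀ w ∈ U, Summable fun n : ℕ => logGammaTerm n w := fun w hw =>
    summable_of_summable_hasDerivAt_of_isPreconnected hu hUo hUc hder hbound h1U h0 hw
  have hexp : ∀ w ∈ U, Complex.exp (∑' n : ℕ, logGammaTerm n w) =
      Complex.exp ((w - 1) * Real.eulerMascheroniConstant) * Complex.Gamma w := by
    intro w hw
    have hl := ((hsum w hw).hasSum.tendsto_sum_nat.comp (tendsto_add_atTop_nat 1)).cexp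
    have hr := ((tendsto_sum_inv_sub_log.const_mul (w - 1)).cexp).mul
      ((Complex.GammaSeq_tendsto_Gamma w).div (Complex.GammaSeq_tendsto_Gamma 1) (by simp))
    rw [Complex.Gamma_one, div_one] at hr
    refine tendsto_nhds_unique hl (hr.congr' ?_)
    filter_upwards [eventually_ne_atTop 0] with N hN
    exact (exp_sum_logGammaTerm (hpos w hw) hN).symm
  have hΓ : Complex.Gamma =ᶠ[𝓝 s] fun w => Complex.exp
      ((∑' n : ℕ, logGammaTerm n w) - (w - 1) * Real.eulerMascheroniConstant) := by
    filter_upwards [hUo.mem_nhds hsU] with w hw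
    rw [Complex.exp_sub, hexp w hw, mul_div_cancel_left₀ _ (Complex.exp_ne_zero _)]
  have hd := ((hG s hsU).sub
    (((hasDerivAt_id s).sub_const 1).mul_const (Real.eulerMascheroniConstant : ℂ))).cexp
  have hval : _root_.digamma s =
      (∑' n : ℕ, (((n : ℂ) + 1)⁻¹ - (s + n)⁻¹)) - Real.eulerMascheroniConstant := by
    rw [_root_.digamma, hΓ.deriv_eq, hΓ.self_of_nhds]
    refine (congrArg (· / _) hd.deriv).trans ?_
    simp
  rw [hval, sub_add_cancel]
  exact (Summable.of_norm_bounded hu fun n => hbound n s hsU).hasSum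

/-- The bound for the terms of the series `ψ(1/4 + ix/2) - ψ(1/4)`. -/
lemma norm_inv_sub_inv_vertical_le (x : ℝ) (n : ℕ) :
    ‖((1 / 4 : ℂ) + n)⁻¹ - (1 / 4 + I * x / 2 + n)⁻¹‖ ≤
      |x| * (1 + |x|) ^ (-(3 / 4) : ℝ) * (4 * (1 / |(n : ℝ) + 1 / 4| ^ (5 / 4 : ℝ))) := by
  have hn : (0 : ℝ) ≤ n := n.cast_nonneg
  have hx : 0 ≤ |x| := abs_nonneg x
  set y : ℝ := (n : ℝ) + 1 / 4 with hy
  have hy0 : 0 < y := by positivity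
  set q : ℂ := 1 / 4 + I * x / 2 + n with hq
  have hqre : q.re = y := by simp [hq, hy]; ring
  have hqim : q.im = x / 2 := by simp [hq]
  have h1 : y ≤ ‖q‖ := hqre ▸ Complex.re_le_norm q
  have h2 : |x| / 2 ≤ ‖q‖ := by
    have := Complex.abs_im_le_norm q
    rwa [hqim, abs_div, abs_two] at this
  have h3 : (1 + |x|) / 8 ≤ ‖q‖ := by linarith
  have hq0 : 0 < ‖q‖ := hy0.trans_le h1
  have hyc : ((1 / 4 : ℂ) + n) = (y : ℂ) := by rw [hy]; push_cast; ring
  have hyn : ‖((1 / 4 : ℂ) + n)‖ = y := by rw [hyc, Complex.norm_real, Real.norm_of_nonneg hy0.le]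
  have hnum : ‖q - (1 / 4 + n)‖ = |x| / 2 := by
    have : q - (1 / 4 + n) = ((x / 2 : ℝ) : ℂ) * I := by rw [hq]; push_cast; ring
    rw [this, norm_mul, Complex.norm_I, mul_one, Complex.norm_real, Real.norm_eq_abs, abs_div,
      abs_two]
  have hlow : ((1 + |x|) / 8) ^ (3 / 4 : ℝ) * y ^ (1 / 4 : ℝ) ≤ ‖q‖ := by
    calc _ ≤ ‖q‖ ^ (3 / 4 : ℝ) * ‖q‖ ^ (1 / 4 : ℝ) := by gcongr
      _ = ‖q‖ := by rw [← Real.rpow_add hq0]; norm_num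
  have h8 : (8 : ℝ) ^ (3 / 4 : ℝ) ≤ 8 := by
    conv_rhs => rw [← Real.rpow_one 8]
    exact Real.rpow_le_rpow_of_exponent_le (by norm_num) (by norm_num)
  rw [inv_sub_inv (norm_pos_iff.mp (hyn ▸ hy0)) (norm_pos_iff.mp hq0), norm_div, norm_mul, hyn,
    hnum, abs_of_pos hy0]
  calc |x| / 2 / (y * ‖q‖)
      ≤ |x| / 2 / (y * (((1 + |x|) / 8) ^ (3 / 4 : ℝ) * y ^ (1 / 4 : ℝ))) := by gcongr
    _ = |x| * (1 + |x|) ^ (-(3 / 4) : ℝ) *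
          ((8 : ℝ) ^ (3 / 4 : ℝ) / 2 * (1 / y ^ (5 / 4 : ℝ))) := by
        have e1 : y ^ (5 / 4 : ℝ) = y * y ^ (1 / 4 : ℝ) := by
          rw [show (5 / 4 : ℝ) = 1 + 1 / 4 by norm_num, Real.rpow_add hy0, Real.rpow_one]
        rw [e1, Real.div_rpow (by positivity) (by norm_num), Real.rpow_neg (by positivity)]
        field_simp
    _ ≤ _ := by
        gcongr
        linarith

/-- The constant in the growth bound for `ψ(1/4 + ix/2)`. -/
def verticalConst : ℝ := ∑' n : ℕ, 4 * (1 / |(n : ℝ) + 1 / 4| ^ (5 / 4 : ℝ))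

lemma summable_verticalConst :
    Summable fun n : ℕ => 4 * (1 / |(n : ℝ) + 1 / 4| ^ (5 / 4 : ℝ)) :=
  ((Real.summable_one_div_nat_add_rpow (1 / 4) (5 / 4)).mpr (by norm_num)).mul_left 4

lemma verticalConst_nonneg : 0 ≤ verticalConst := tsum_nonneg fun n => by positivity

lemma norm_mul_inv_sub_inv_vertical_le {c : ℂ} (hc : ‖c‖ ≤ 1) (x : ℝ) (n : ℕ) :
    ‖c ^ n * (((1 / 4 : ℂ) + n)⁻¹ - (1 / 4 + I * x / 2 + n)⁻¹)‖ ≤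
      |x| * (1 + |x|) ^ (-(3 / 4) : ℝ) * (4 * (1 / |(n : ℝ) + 1 / 4| ^ (5 / 4 : ℝ))) := by
  rw [norm_mul, norm_pow]
  exact (mul_le_of_le_one_left (norm_nonneg _) (pow_le_one₀ (norm_nonneg _) hc)).trans
    (norm_inv_sub_inv_vertical_le x n)

lemma summable_mul_inv_sub_inv_vertical {c : ℂ} (hc : ‖c‖ ≤ 1) (x : ℝ) :
    Summable fun n : ℕ => c ^ n * (((1 / 4 : ℂ) + n)⁻¹ - (1 / 4 + I * x / 2 + n)⁻¹) :=
  Summable.of_norm_bounded (summable_verticalConst.mul_left _)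
    (norm_mul_inv_sub_inv_vertical_le hc x)

lemma norm_tsum_mul_inv_sub_inv_vertical_le {c : ℂ} (hc : ‖c‖ ≤ 1) (x : ℝ) :
    ‖∑' n : ℕ, c ^ n * (((1 / 4 : ℂ) + n)⁻¹ - (1 / 4 + I * x / 2 + n)⁻¹)‖ ≤
      verticalConst * (|x| * (1 + |x|) ^ (-(3 / 4) : ℝ)) := by
  rw [verticalConst, mul_comm (∑' _, _)]
  exact tsum_of_norm_bounded (summable_verticalConst.hasSum.mul_left _)
    (norm_mul_inv_sub_inv_vertical_le hc x)

lemma norm_digamma_vertical_sub_le (x : ℝ) :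
    ‖_root_.digamma (1 / 4) - _root_.digamma (1 / 4 + I * x / 2)‖ ≤
      verticalConst * (|x| * (1 + |x|) ^ (-(3 / 4) : ℝ)) := by
  have h1 : HasSum _ _ := hasSum_digamma (s := 1 / 4) (by norm_num)
  have h2 := hasSum_digamma (s := 1 / 4 + I * x / 2) (by simp)
  have h3 := (h2.sub h1).tsum_eq
  rw [norm_sub_rev]
  have h4 := norm_tsum_mul_inv_sub_inv_vertical_le (c := 1) (by simp) x
  simp only [one_pow, one_mul] at h4
  rw [add_sub_add_right_eq_sub] at h3
  simp only [sub_sub_sub_cancel_left] at h3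
  rwa [h3] at h4

lemma not_summable_inv_quarter_add : ¬ Summable fun n : ℕ => ((1 / 4 : ℂ) + n)⁻¹ := by
  intro h
  have h1 := (Complex.reCLM.summable h).abs
  refine (Real.summable_one_div_nat_add_rpow (1 / 4) 1).not.mpr (lt_irrefl 1) (h1.congr fun n => ?_)
  have : ((1 / 4 : ℂ) + n)⁻¹ = (((n : ℝ) + 1 / 4)⁻¹ : ℝ) := by push_cast; ring
  rw [this, Complex.reCLM_apply, Complex.ofReal_re, Real.rpow_one, abs_inv, inv_eq_one_div]

lemma PhiC_one_right (c a : ℂ) : PhiC c 1 a = ∑' n : ℕ, c ^ n * (a + n)⁻¹ := by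
  simp only [PhiC, Complex.cpow_one, div_eq_mul_inv, add_comm]

lemma norm_inv_vertical_le (x : ℝ) (n : ℕ) : ‖((1 / 4 : ℂ) + I * x / 2 + n)⁻¹‖ ≤ 4 := by
  have h := Complex.re_le_norm ((1 / 4 : ℂ) + I * x / 2 + n)
  have hn : (0 : ℝ) ≤ n := n.cast_nonneg
  have hre : ((1 / 4 : ℂ) + I * x / 2 + n).re = 1 / 4 + n := by simp
  rw [norm_inv]
  refine inv_le_of_inv_le₀ (by norm_num) ?_
  linarith

/-- At `t = 0` both series diverge, so that both `PhiC` values are zero by convention. -/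
lemma PhiC_sub_PhiC_vertical {t : ℝ} (ht : 0 ≤ t) (x : ℝ) :
    PhiC (Real.exp (-2 * t)) 1 (1 / 4) - PhiC (Real.exp (-2 * t)) 1 ((1 / 2 + I * x) / 2) =
      if t = 0 then 0 else
        ∑' n : ℕ, (Real.exp (-2 * t) : ℂ) ^ n *
          (((1 / 4 : ℂ) + n)⁻¹ - (1 / 4 + I * x / 2 + n)⁻¹) := by
  rw [show ((1 / 2 + I * (x : ℂ)) / 2) = 1 / 4 + I * x / 2 by ring, PhiC_one_right, PhiC_one_right]
  split_ifs with h0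
  · subst h0
    simp only [mul_zero, Real.exp_zero, Complex.ofReal_one, one_pow, one_mul]
    rw [tsum_eq_zero_of_not_summable not_summable_inv_quarter_add, tsum_eq_zero_of_not_summable,
      sub_zero]
    intro h
    have h1 := (summable_mul_inv_sub_inv_vertical (c := 1) (by simp) x).add h
    simp only [one_pow, one_mul, sub_add_cancel] at h1
    exact not_summable_inv_quarter_add h1
  · have hlt : ‖(Real.exp (-2 * t) : ℂ)‖ < 1 := by
      rw [Complex.norm_real, Real.norm_of_nonneg (Real.exp_pos _).le, Real.exp_lt_one_iff]
      have : 0 < t := lt_of_le_of_ne ht (Ne.symm h0)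
      linarith
    have hs : ∀ y : ℝ, Summable fun n : ℕ =>
        (Real.exp (-2 * t) : ℂ) ^ n * ((1 / 4 : ℂ) + I * y / 2 + n)⁻¹ := fun y => by
      refine Summable.of_norm_bounded
        ((summable_geometric_of_lt_one (norm_nonneg _) hlt).mul_right 4) fun n => ?_
      rw [norm_mul, norm_pow]
      gcongr
      exact norm_inv_vertical_le y n
    have hs0 := hs 0
    simp only [Complex.ofReal_zero, mul_zero, zero_div, add_zero] at hs0
    rw [← hs0.tsum_sub (hs x)]
    simp only [mul_sub]

lemma norm_ofReal_exp_neg_le_one {t : ℝ} (ht : 0 ≤ t) : ‖(Real.exp (-2 * t) : ℂ)‖ ≤ 1 := by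
  rw [Complex.norm_real, Real.norm_of_nonneg (Real.exp_pos _).le, Real.exp_le_one_iff]
  linarith

lemma norm_PhiC_sub_PhiC_vertical_le {t : ℝ} (ht : 0 ≤ t) (x : ℝ) :
    ‖PhiC (Real.exp (-2 * t)) 1 (1 / 4) - PhiC (Real.exp (-2 * t)) 1 ((1 / 2 + I * x) / 2)‖ ≤
      verticalConst * (|x| * (1 + |x|) ^ (-(3 / 4) : ℝ)) := by
  rw [PhiC_sub_PhiC_vertical ht]
  split_ifs
  · rw [norm_zero]
    have := verticalConst_nonneg
    positivity
  · exact norm_tsum_mul_inv_sub_inv_vertical_le (norm_ofReal_exp_neg_le_one ht) x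

lemma measurable_PhiC_sub_PhiC_vertical {t : ℝ} (ht : 0 ≤ t) :
    Measurable fun x : ℝ =>
      PhiC (Real.exp (-2 * t)) 1 (1 / 4) -
        PhiC (Real.exp (-2 * t)) 1 ((1 / 2 + I * (x : ℂ)) / 2) := by
  simp only [PhiC_sub_PhiC_vertical ht]
  split_ifs
  · exact measurable_const
  · refine measurable_of_tendsto_metrizable
      (f := fun (N : ℕ) (x : ℝ) => ∑ n ∈ Finset.range N, (Real.exp (-2 * t) : ℂ) ^ n *
        (((1 / 4 : ℂ) + n)⁻¹ - (1 / 4 + I * (x : ℂ) / 2 + n)⁻¹))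
      (fun N => Finset.measurable_sum _ fun n _ => ?_) (tendsto_pi_nhds.mpr fun x =>
        (summable_mul_inv_sub_inv_vertical (norm_ofReal_exp_neg_le_one ht)
          x).hasSum.tendsto_sum_nat)
    fun_prop

lemma xi_conj (s : ℂ) : xi ((starRingEnd ℂ) s) = (starRingEnd ℂ) (xi s) := by
  have hpow : (π : ℂ) ^ (-(starRingEnd ℂ) s / 2) = (starRingEnd ℂ) ((π : ℂ) ^ (-s / 2)) := by
    have h := Complex.cpow_conj (π : ℂ) (-s / 2)
      (by rw [Complex.arg_ofReal_of_nonneg Real.pi_pos.le]; exact Real.pi_pos.ne)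
    rw [Complex.conj_ofReal] at h
    rw [← h, map_div₀, map_neg, map_ofNat]
  have hΓ : Complex.Gamma ((starRingEnd ℂ) s / 2) = (starRingEnd ℂ) (Complex.Gamma (s / 2)) := by
    rw [← Complex.Gamma_conj, map_div₀, map_ofNat]
  simp only [xi, hpow, hΓ, riemannZeta_conj, map_mul, map_div₀, map_sub, map_one, map_ofNat]

lemma Zfun_eq_completedRiemannZeta {s : ℂ} (hs : 0 < s.re) : Zfun s = completedRiemannZeta s := by
  have h0 : s ≠ 0 := fun h => by simp [h] at hs
  rw [Zfun, riemannZeta_def_of_ne_zero h0, ← Gammaℝ_def,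
    mul_div_cancel₀ _ (Gammaℝ_ne_zero_of_re_pos hs)]

lemma xi_eq_mul_Zfun (s : ℂ) : xi s = s * (s - 1) / 2 * Zfun s := by
  rw [xi, Zfun]
  ring

lemma xi_one_sub {s : ℂ} (h0 : 0 < s.re) (h1 : s.re < 1) : xi (1 - s) = xi s := by
  rw [xi_eq_mul_Zfun, xi_eq_mul_Zfun, Zfun_eq_completedRiemannZeta h0,
    Zfun_eq_completedRiemannZeta (by simpa using h1), completedRiemannZeta_one_sub]
  ring

lemma deriv_xi_one_sub {s : ℂ} (h0 : 0 < s.re) (h1 : s.re < 1) :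
    deriv xi (1 - s) = -deriv xi s := by
  have h : (fun w => xi (1 - w)) =ᶠ[𝓝 s] xi := by
    filter_upwards [(isOpen_lt continuous_const Complex.continuous_re).mem_nhds h0,
      (isOpen_lt Complex.continuous_re continuous_const).mem_nhds h1] with w hw0 hw1
    exact xi_one_sub hw0 hw1
  rw [← h.deriv_eq, deriv_comp_const_sub, neg_neg]

lemma deriv_xi_conj (s : ℂ) : deriv xi ((starRingEnd ℂ) s) = (starRingEnd ℂ) (deriv xi s) := by
  have h : (starRingEnd ℂ) ∘ xi ∘ (starRingEnd ℂ) = xi := by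
    ext w
    simp [xi_conj]
  conv_lhs => rw [← h, deriv_conj_conj]
  simp

lemma conj_half_sub (x : ℝ) : (starRingEnd ℂ) (1 / 2 - I * x) = 1 - (1 / 2 - I * x) := by
  simp only [map_sub, map_div₀, map_one, map_ofNat, map_mul, Complex.conj_I, Complex.conj_ofReal]
  ring

lemma half_sub_re (x : ℝ) : (1 / 2 - I * (x : ℂ)).re = 1 / 2 := by simp

lemma conj_xi_half_sub (x : ℝ) : (starRingEnd ℂ) (xi (1 / 2 - I * x)) = xi (1 / 2 - I * x) := by
  rw [← xi_conj, conj_half_sub, xi_one_sub] <;> norm_num [half_sub_re]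

lemma conj_deriv_xi_half_sub (x : ℝ) :
    (starRingEnd ℂ) (deriv xi (1 / 2 - I * x)) = -deriv xi (1 / 2 - I * x) := by
  rw [← deriv_xi_conj, conj_half_sub, deriv_xi_one_sub] <;> norm_num [half_sub_re]

lemma norm_one_add_Theta_le (x : ℝ) : ‖1 + Theta x‖ ≤ 2 := by
  have h : ‖Theta x‖ ≤ 1 := by
    rw [Theta, Complex.conj_ofReal, norm_div, RCLike.norm_conj]
    exact div_self_le_one _
  calc ‖1 + Theta x‖ ≤ ‖(1 : ℂ)‖ + ‖Theta x‖ := norm_add_le _ _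
    _ ≤ 2 := by rw [norm_one]; linarith

/-- `1 + Θ` cancels the poles of `ξ'/ξ` on the real line. -/
lemma norm_one_add_Theta_mul_logDeriv_xi_le {x : ℝ} (hξ : xi (1 / 2 - I * x) ≠ 0) :
    ‖(1 + Theta x) * (deriv xi (1 / 2 - I * x) / xi (1 / 2 - I * x))‖ ≤ 2 := by
  have h1 := conj_xi_half_sub x
  have h2 := conj_deriv_xi_half_sub x
  have hE : Efun x = xi (1 / 2 - I * x) + deriv xi (1 / 2 - I * x) := rfl
  have hΘ : Theta x = (starRingEnd ℂ) (Efun x) / Efun x := by rw [Theta, Complex.conj_ofReal]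
  set a := xi (1 / 2 - I * x)
  set b := deriv xi (1 / 2 - I * x)
  have hcE : (starRingEnd ℂ) (Efun x) = a - b := by rw [hE, map_add, h1, h2]; ring
  have hE0 : Efun x ≠ 0 := by
    intro h
    rw [h, map_zero] at hcE
    rw [h] at hE
    apply hξ
    linear_combination (-1 / 2 : ℂ) * hE - (1 / 2 : ℂ) * hcE
  have hprod : (1 + Theta x) * (b / a) = 2 * b / Efun x := by
    rw [hΘ, hcE]
    field_simp
    rw [hE]
    ring
  have hb : 2 * b = Efun x - (starRingEnd ℂ) (Efun x) := by rw [hcE, hE]; ring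
  have hb2 : ‖2 * b‖ ≤ 2 * ‖Efun x‖ := by
    rw [hb]
    refine (norm_sub_le _ _).trans_eq ?_
    rw [RCLike.norm_conj]
    ring
  rw [hprod, norm_div]
  exact div_le_of_le_mul₀ (norm_nonneg _) zero_le_two hb2

lemma logDeriv_Zfun_half_sub {x : ℝ} (hZ : Zfun (1 / 2 - I * x) ≠ 0) :
    deriv Zfun (1 / 2 - I * x) / Zfun (1 / 2 - I * x) =
      deriv xi (1 / 2 - I * x) / xi (1 / 2 - I * x) - 2 * I * x / (1 / 4 + x ^ 2) := by
  set s : ℂ := 1 / 2 - I * x with hs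
  have hre : s.re = 1 / 2 := half_sub_re x
  have h0 : s ≠ 0 := fun h => by simp [h] at hre
  have h1 : s ≠ 1 := fun h => by norm_num [h] at hre
  have hZev : Zfun =ᶠ[𝓝 s] completedRiemannZeta := by
    filter_upwards [(isOpen_lt continuous_const Complex.continuous_re).mem_nhds
      (show (0 : ℝ) < s.re by rw [hre]; norm_num)] with w hw
    exact Zfun_eq_completedRiemannZeta hw
  have hdZ : DifferentiableAt ℂ Zfun s :=
    (differentiableAt_completedZeta h0 h1).congr_of_eventuallyEq hZev
  have hp : HasDerivAt (fun w : ℂ => w * (w - 1) / 2) (s - 1 / 2) s := by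
    have := ((hasDerivAt_id s).mul ((hasDerivAt_id s).sub_const 1)).div_const 2
    refine this.congr_deriv ?_
    simp only [id_eq]
    ring
  have hdxi : deriv xi s = (s - 1 / 2) * Zfun s + s * (s - 1) / 2 * deriv Zfun s := by
    have : xi = fun w => w * (w - 1) / 2 * Zfun w := funext xi_eq_mul_Zfun
    rw [this]
    exact (hp.mul hdZ.hasDerivAt).deriv
  have hsub : s - 1 ≠ 0 := sub_ne_zero.mpr h1
  have hden : (1 / 4 + (x : ℂ) ^ 2) = -(s * (s - 1)) := by
    rw [hs]
    linear_combination (x : ℂ) ^ 2 * Complex.I_sq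
  have hnum : 2 * I * x = 1 - 2 * s := by rw [hs]; ring
  rw [hdxi, xi_eq_mul_Zfun, hden, hnum]
  field_simp
  ring

lemma norm_one_add_Theta_mul_logDeriv_Zfun_le (x : ℝ) :
    ‖(1 + Theta x) * (deriv Zfun (1 / 2 - I * x) / Zfun (1 / 2 - I * x))‖ ≤ 6 := by
  by_cases hZ : Zfun (1 / 2 - I * x) = 0
  · rw [hZ, div_zero, mul_zero, norm_zero]
    norm_num
  have hre := half_sub_re x
  have h0 : (1 / 2 - I * (x : ℂ)) ≠ 0 := fun h => by
    rw [h, Complex.zero_re] at hre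
    norm_num at hre
  have h1 : (1 / 2 - I * (x : ℂ)) - 1 ≠ 0 := fun h => by
    rw [sub_eq_zero.mp h, Complex.one_re] at hre
    norm_num at hre
  have hξ : xi (1 / 2 - I * x) ≠ 0 := by
    rw [xi_eq_mul_Zfun]
    exact mul_ne_zero (div_ne_zero (mul_ne_zero h0 h1) two_ne_zero) hZ
  have hq : ‖2 * I * (x : ℂ) / (1 / 4 + x ^ 2)‖ ≤ 2 := by
    have : (1 / 4 + (x : ℂ) ^ 2) = ((1 / 4 + x ^ 2 : ℝ) : ℂ) := by push_cast; rfl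
    rw [this, norm_div, norm_mul, norm_mul, Complex.norm_I, Complex.norm_real, Complex.norm_real,
      Real.norm_of_nonneg (by positivity : (0 : ℝ) ≤ 1 / 4 + x ^ 2), Real.norm_eq_abs,
      Complex.norm_ofNat]
    refine div_le_of_le_mul₀ (by positivity) zero_le_two ?_
    nlinarith [sq_nonneg (|x| - 1 / 2), sq_abs x]
  rw [logDeriv_Zfun_half_sub hZ, mul_sub]
  calc _ ≤ _ := norm_sub_le _ _
    _ ≤ 2 + 2 * 2 := by
        refine add_le_add (norm_one_add_Theta_mul_logDeriv_xi_le hξ) ?_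
        rw [norm_mul]
        exact mul_le_mul (norm_one_add_Theta_le x) hq (norm_nonneg _) zero_le_two
    _ = 6 := by norm_num

lemma inv_one_add_abs_le_rpow (x : ℝ) : (1 + |x|)⁻¹ ≤ (1 + |x|) ^ (-(3 / 4) : ℝ) := by
  rw [← Real.rpow_neg_one]
  exact Real.rpow_le_rpow_of_exponent_le (by linarith [abs_nonneg x]) (by norm_num)

lemma norm_exp_sub_one_div_le (x u : ℝ) :
    ‖(Complex.exp (I * x * u) - 1) / (I * x)‖ ≤ (|u| + 2) * (1 + |x|)⁻¹ := by
  have hu := abs_nonneg u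
  have hx := abs_nonneg x
  rcases eq_or_ne x 0 with rfl | hx0
  · simpa using by positivity
  have hxp : 0 < |x| := abs_pos.mpr hx0
  have harg : I * x * u = I * ((x * u : ℝ) : ℂ) := by push_cast; ring
  have h1 : ‖Complex.exp (I * x * u) - 1‖ ≤ |x| * |u| := by
    rw [harg, ← abs_mul]
    exact Real.norm_exp_I_mul_ofReal_sub_one_le
  have h2 : ‖Complex.exp (I * x * u) - 1‖ ≤ 2 := by
    refine (norm_sub_le _ _).trans ?_
    rw [harg, Complex.norm_exp_I_mul_ofReal, norm_one]
    norm_num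
  rw [norm_div, norm_mul, Complex.norm_I, one_mul, Complex.norm_real, Real.norm_eq_abs,
    ← div_eq_mul_inv, div_le_div_iff₀ hxp (by positivity)]
  nlinarith

lemma norm_one_div_two_I_mul_mul_le {x C : ℝ} {a : ℂ} (hC : 0 ≤ C) (ha : ‖a‖ ≤ C * |x|) :
    ‖1 / (2 * I * (x : ℂ)) * a‖ ≤ C := by
  rw [one_div_mul_eq_div, norm_div, norm_mul, norm_mul, Complex.norm_I, Complex.norm_real,
    Real.norm_eq_abs, Complex.norm_ofNat, mul_one]
  refine div_le_of_le_mul₀ (by positivity) hC ?_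
  nlinarith [mul_nonneg hC (abs_nonneg x)]

lemma norm_div_one_add_two_I_mul_le {x y C : ℝ} {a : ℂ} (hy : |y| = |x|) (ha : ‖a‖ ≤ C) :
    ‖4 * a / (1 + 2 * I * (y : ℂ))‖ ≤ 8 * C * (1 + |x|)⁻¹ := by
  have hC := (norm_nonneg a).trans ha
  have hx := abs_nonneg x
  have h1 := Complex.re_le_norm (1 + 2 * I * (y : ℂ))
  have h2 := Complex.abs_im_le_norm (1 + 2 * I * (y : ℂ))
  have hre : (1 + 2 * I * (y : ℂ)).re = 1 := by simp
  have him : (1 + 2 * I * (y : ℂ)).im = 2 * y := by simp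
  rw [hre] at h1
  rw [him, abs_mul, abs_two, hy] at h2
  rw [norm_div, norm_mul, Complex.norm_ofNat, ← div_eq_mul_inv,
    div_le_div_iff₀ (by linarith) (by linarith)]
  calc 4 * ‖a‖ * (1 + |x|) ≤ 4 * C * (2 * ‖1 + 2 * I * (y : ℂ)‖) := by
        gcongr
        linarith
    _ = _ := by ring

/-- The part of the bound for `𝔖_t` coming from the sum over prime powers. -/
def primeSumConst (T : ℝ) : ℝ :=
  ∑ n ∈ Finset.Icc 1 ⌊Real.exp T⌋₊, |vM n / Real.sqrt n| * (T + 2)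

lemma norm_primeSum_le {t T : ℝ} (ht : 0 ≤ t) (htT : t ≤ T) (x : ℝ) :
    ‖∑ n ∈ Finset.Icc 1 ⌊Real.exp t⌋₊, ((vM n / Real.sqrt n : ℝ) : ℂ) *
        ((Complex.exp (I * x * ((t : ℝ) - Real.log n)) - 1) / (I * x))‖ ≤
      primeSumConst T * (1 + |x|)⁻¹ := by
  rw [primeSumConst, Finset.sum_mul]
  have hx := abs_nonneg x
  have hT : 0 ≤ T := ht.trans htT
  calc _ ≤ ∑ n ∈ Finset.Icc 1 ⌊Real.exp t⌋₊, |vM n / Real.sqrt n| * (T + 2) * (1 + |x|)⁻¹ := by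
        refine norm_sum_le_of_le _ fun n hn => ?_
        rw [Finset.mem_Icc] at hn
        have hn1 : (1 : ℝ) ≤ n := by exact_mod_cast hn.1
        have hn2 : (n : ℝ) ≤ Real.exp t := (Nat.le_floor_iff (Real.exp_pos t).le).mp hn.2
        have hl0 := Real.log_nonneg hn1
        have hl1 : Real.log n ≤ t := (Real.log_le_iff_le_exp (by linarith)).mpr hn2
        have habs : |t - Real.log n| ≤ T := abs_le.mpr ⟨by linarith, by linarith⟩
        have h := norm_exp_sub_one_div_le x (t - Real.log n)
        rw [Complex.ofReal_sub] at h
        rw [norm_mul, Complex.norm_real, Real.norm_eq_abs, mul_assoc |vM n / _|]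
        refine mul_le_mul_of_nonneg_left (h.trans ?_) (abs_nonneg _)
        gcongr
    _ ≤ _ := Finset.sum_le_sum_of_subset_of_nonneg
        (Finset.Icc_subset_Icc_right (Nat.floor_mono (Real.exp_le_exp.mpr htT)))
        fun n _ _ => by positivity

/-- The constant in the pointwise bound for `𝔖_t` with `|t| ≤ T`. -/
def screwConst (T : ℝ) : ℝ :=
  2 * (8 * (Real.exp (T / 2) + 1) + 8 * 1 + primeSumConst T + verticalConst + verticalConst) +
    (T + 2) * (6 + Real.log π + ‖_root_.digamma (1 / 4)‖ + verticalConst)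

lemma norm_Sfrak_le_norm_mul (t x : ℝ) : ‖Sfrak t x‖ ≤ ‖(1 + Theta x) * Pfrak |t| x‖ := by
  have hπ : 1 ≤ 2 * Real.sqrt π := by
    have : 1 ≤ Real.sqrt π := Real.one_le_sqrt.mpr (by linarith [Real.pi_gt_three])
    linarith
  have : Sfrak t x = I * ((1 + Theta x) * Pfrak |t| x) / ((2 * Real.sqrt π : ℝ) : ℂ) := by
    rw [Sfrak]
    push_cast
    ring
  rw [this, norm_div, norm_mul, Complex.norm_I, one_mul, Complex.norm_real,
    Real.norm_of_nonneg (by linarith)]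
  exact div_le_self (norm_nonneg _) hπ

lemma norm_Sfrak_le {t T : ℝ} (htT : |t| ≤ T) (x : ℝ) :
    ‖Sfrak t x‖ ≤ screwConst T * (1 + |x|) ^ (-(3 / 4) : ℝ) := by
  refine (norm_Sfrak_le_norm_mul t x).trans ?_
  have ht : 0 ≤ |t| := abs_nonneg t
  set τ := |t|
  have hT : 0 ≤ T := ht.trans htT
  have hx := abs_nonneg x
  have hV := verticalConst_nonneg
  have hinv := inv_one_add_abs_le_rpow x
  have hdig := norm_digamma_vertical_sub_le x
  have hPhi := norm_PhiC_sub_PhiC_vertical_le ht x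
  have hE := norm_exp_sub_one_div_le x τ
  have hS := norm_primeSum_le ht htT x
  have hS0 : 0 ≤ primeSumConst T := Finset.sum_nonneg fun n _ => by positivity
  have hΘ := norm_one_add_Theta_le x
  have hZ := norm_one_add_Theta_mul_logDeriv_Zfun_le x
  have hA : ‖4 * ((Real.exp (τ / 2) : ℂ) - 1) / (1 - 2 * I * x)‖ ≤
      8 * (Real.exp (T / 2) + 1) * (1 + |x|)⁻¹ := by
    have h : ‖(Real.exp (τ / 2) : ℂ) - 1‖ ≤ Real.exp (T / 2) + 1 := by
      refine (norm_sub_le _ _).trans ?_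
      rw [Complex.norm_real, Real.norm_of_nonneg (Real.exp_pos _).le, norm_one]
      gcongr
    have := norm_div_one_add_two_I_mul_le (abs_neg x) h
    rwa [Complex.ofReal_neg, mul_neg, ← sub_eq_add_neg] at this
  have hB : ‖4 * ((Real.exp (-τ / 2) : ℂ) - 1) / (1 + 2 * I * x)‖ ≤ 8 * 1 * (1 + |x|)⁻¹ := by
    refine norm_div_one_add_two_I_mul_le rfl ?_
    rw [← Complex.ofReal_one, ← Complex.ofReal_sub, Complex.norm_real, Real.norm_eq_abs, abs_le]
    have h1 := Real.exp_pos (-τ / 2)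
    have h2 : Real.exp (-τ / 2) ≤ 1 := Real.exp_le_one_iff.mpr (by linarith)
    constructor <;> linarith
  set w := (1 + |x|)⁻¹ with hw
  set h := (1 + |x|) ^ (-(3 / 4) : ℝ) with hh
  have hw0 : 0 ≤ w := by positivity
  have hh0 : 0 ≤ h := by positivity
  have hwx : w * |x| ≤ 1 := by
    rw [hw, inv_mul_le_iff₀ (by positivity)]
    linarith
  have hD : ‖1 / (2 * I * (x : ℂ)) * (_root_.digamma (1 / 4) - _root_.digamma (1 / 4 + I * x / 2))‖
      ≤ verticalConst * h :=
    norm_one_div_two_I_mul_mul_le (by positivity) (hdig.trans_eq (by ring))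
  have hF : ‖1 / (2 * I * (x : ℂ)) * (Real.exp (-τ / 2) : ℂ) *
      (PhiC (Real.exp (-2 * τ)) 1 (1 / 4) - PhiC (Real.exp (-2 * τ)) 1 ((1 / 2 + I * x) / 2))‖
      ≤ verticalConst * h := by
    rw [mul_assoc]
    refine norm_one_div_two_I_mul_mul_le (by positivity) ?_
    rw [norm_mul, Complex.norm_real, Real.norm_of_nonneg (Real.exp_pos _).le]
    refine (mul_le_of_le_one_left (norm_nonneg _) ?_).trans (hPhi.trans_eq (by ring))
    exact Real.exp_le_one_iff.mpr (by linarith)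
  have hψ : ‖_root_.digamma (1 / 4 + I * x / 2)‖ ≤
      ‖_root_.digamma (1 / 4)‖ + verticalConst * (|x| * h) := by
    have := norm_le_norm_add_norm_sub (_root_.digamma (1 / 4)) (_root_.digamma (1 / 4 + I * x / 2))
    linarith
  have hlogπ : 0 ≤ Real.log π := Real.log_nonneg (by linarith [Real.pi_gt_three])
  have hexp : Complex.exp (I * τ * x) = Complex.exp (I * x * τ) := by ring_nf
  rw [Pfrak, hexp]
  set A := 4 * ((Real.exp (τ / 2) : ℂ) - 1) / (1 - 2 * I * x)
  set B := 4 * ((Real.exp (-τ / 2) : ℂ) - 1) / (1 + 2 * I * x)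
  set S := ∑ n ∈ Finset.Icc 1 ⌊Real.exp τ⌋₊, ((vM n / Real.sqrt n : ℝ) : ℂ) *
        ((Complex.exp (I * x * ((τ : ℝ) - Real.log n)) - 1) / (I * x))
  set E := (Complex.exp (I * x * τ) - 1) / (I * x)
  set Q := deriv Zfun (1 / 2 - I * x) / Zfun (1 / 2 - I * x)
  set D := 1 / (2 * I * (x : ℂ)) * (_root_.digamma (1 / 4) - _root_.digamma (1 / 4 + I * x / 2))
  set F := 1 / (2 * I * (x : ℂ)) * (Real.exp (-τ / 2) : ℂ) *
      (PhiC (Real.exp (-2 * τ)) 1 (1 / 4) - PhiC (Real.exp (-2 * τ)) 1 ((1 / 2 + I * x) / 2))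
  set θ := 1 + Theta x
  set ψ := _root_.digamma (1 / 4 + I * x / 2)
  have hsplit : θ * (A + B - S + E * (Q - 1 / 2 * (Real.log π : ℂ) + 1 / 2 * ψ) - D - F) =
      θ * (A + B - S - D - F) + E * (θ * Q + θ * (1 / 2 * (ψ - (Real.log π : ℂ)))) := by ring
  have hM : ‖A + B - S - D - F‖ ≤ (8 * (Real.exp (T / 2) + 1) + 8 * 1 + primeSumConst T +
      verticalConst + verticalConst) * h := by
    have e1 := norm_sub_le (A + B - S - D) F
    have e2 := norm_sub_le (A + B - S) D
    have e3 := norm_sub_le (A + B) S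
    have e4 := norm_add_le A B
    have e5 : (8 * (Real.exp (T / 2) + 1) + 8 * 1 + primeSumConst T) * w ≤
      (8 * (Real.exp (T / 2) + 1) + 8 * 1 + primeSumConst T) * h := by gcongr
    linarith
  have hN : ‖θ * Q + θ * (1 / 2 * (ψ - (Real.log π : ℂ)))‖ ≤
      6 + (‖_root_.digamma (1 / 4)‖ + verticalConst * (|x| * h) + Real.log π) := by
    have e1 : ‖ψ - (Real.log π : ℂ)‖ ≤
        ‖_root_.digamma (1 / 4)‖ + verticalConst * (|x| * h) + Real.log π := by
      refine (norm_sub_le _ _).trans ?_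
      rw [Complex.norm_real, Real.norm_of_nonneg hlogπ]
      linarith
    refine (norm_add_le _ _).trans (add_le_add hZ ?_)
    rw [norm_mul, norm_mul]
    have e2 : ‖(1 / 2 : ℂ)‖ = 1 / 2 := by norm_num
    rw [e2]
    nlinarith [norm_nonneg (ψ - (Real.log π : ℂ))]
  have hE' : ‖E‖ ≤ (T + 2) * w := by
    refine hE.trans ?_
    rw [abs_of_nonneg ht]
    gcongr
  rw [hsplit]
  calc _ ≤ ‖θ‖ * ‖A + B - S - D - F‖ + ‖E‖ * ‖θ * Q + θ * (1 / 2 * (ψ - (Real.log π : ℂ)))‖ := by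
        rw [← norm_mul, ← norm_mul]
        exact norm_add_le _ _
    _ ≤ 2 * ((8 * (Real.exp (T / 2) + 1) + 8 * 1 + primeSumConst T +
          verticalConst + verticalConst) * h) +
        (T + 2) * w * (6 + (‖_root_.digamma (1 / 4)‖ + verticalConst * (|x| * h) +
          Real.log π)) := by gcongr
    _ = 2 * (8 * (Real.exp (T / 2) + 1) + 8 * 1 + primeSumConst T +
          verticalConst + verticalConst) * h +
        (T + 2) * ((6 + Real.log π + ‖_root_.digamma (1 / 4)‖) * w +
          verticalConst * (w * |x| * h)) := by ring
    _ ≤ 2 * (8 * (Real.exp (T / 2) + 1) + 8 * 1 + primeSumConst T +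
          verticalConst + verticalConst) * h +
        (T + 2) * ((6 + Real.log π + ‖_root_.digamma (1 / 4)‖) * h +
          verticalConst * (1 * h)) := by gcongr
    _ = screwConst T * h := by rw [screwConst]; ring

lemma measurable_Gamma : Measurable Complex.Gamma := by
  have h := Complex.differentiable_one_div_Gamma.continuous.measurable.inv
  simpa [Pi.inv_def] using h

lemma measurable_riemannZeta : Measurable riemannZeta :=
  measurable_of_continuousOn_compl_singleton 1 fun _ hs =>
    (differentiableAt_riemannZeta hs).continuousAt.continuousWithinAt

lemma measurable_Zfun : Measurable Zfun := by
  have h1 := measurable_Gamma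
  have h2 := measurable_riemannZeta
  unfold Zfun
  fun_prop

lemma measurable_xi : Measurable xi := by
  have h := measurable_Zfun
  rw [show xi = fun s => s * (s - 1) / 2 * Zfun s from funext xi_eq_mul_Zfun]
  fun_prop

lemma measurable_digamma : Measurable _root_.digamma :=
  (measurable_deriv _).div measurable_Gamma

lemma measurable_Theta : Measurable Theta := by
  have h1 := measurable_xi
  have h2 := measurable_deriv xi
  have hE : Measurable Efun := by
    unfold Efun
    fun_prop
  have hc : Measurable (starRingEnd ℂ) := Complex.continuous_conj.measurable
  unfold Theta
  fun_prop

lemma measurable_Pfrak {t : ℝ} (ht : 0 ≤ t) : Measurable fun x : ℝ => Pfrak t x := by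
  have h1 := measurable_PhiC_sub_PhiC_vertical ht
  have h2 := measurable_digamma
  have h3 := measurable_Zfun
  have h4 := measurable_deriv Zfun
  unfold Pfrak
  fun_prop

lemma measurable_Sfrak (t : ℝ) : Measurable fun x : ℝ => Sfrak t x := by
  have h1 := measurable_Pfrak (abs_nonneg t)
  have h2 := measurable_Theta
  unfold Sfrak
  fun_prop

lemma memLp_two_one_add_abs_rpow :
    MemLp (fun x : ℝ => (1 + |x|) ^ (-(3 / 4) : ℝ)) 2 volume := by
  have hc : Continuous fun x : ℝ => (1 + |x|) ^ (-(3 / 4) : ℝ) :=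
    (continuous_const.add continuous_abs).rpow_const fun x =>
      Or.inl (add_pos_of_pos_of_nonneg one_pos (abs_nonneg x)).ne'
  rw [memLp_two_iff_integrable_sq hc.aestronglyMeasurable]
  have h : Integrable (fun x : ℝ => (1 + ‖x‖) ^ (-(3 / 2) : ℝ)) volume :=
    integrable_one_add_norm (by norm_num)
  refine h.congr (ae_of_all _ fun x => ?_)
  simp only [Real.norm_eq_abs]
  rw [← Real.rpow_mul_natCast (by positivity)]
  norm_num

/-- For every fixed `t`, `z ↦ 𝔖_t(z)` restricted to `ℝ` belongs to `L²(ℝ)`, and its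
`L²`-norm is uniformly bounded for `t` in any compact subset of `ℝ`. -/
theorem statement0 :
    (∀ t : ℝ, MemLp (fun x : ℝ => Sfrak t (x : ℂ)) 2 volume) ∧
      ∀ K : Set ℝ, IsCompact K → ∃ C : ℝ, ∀ t ∈ K,
        (eLpNorm (fun x : ℝ => Sfrak t (x : ℂ)) 2 volume).toReal ≤ C := by
  have hdom : ∀ T : ℝ,
      MemLp (fun x : ℝ => screwConst T * (1 + |x|) ^ (-(3 / 4) : ℝ)) 2 volume := fun T =>
    memLp_two_one_add_abs_rpow.const_mul _
  refine ⟨fun t => (hdom |t|).mono' (measurable_Sfrak t).aestronglyMeasurable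
    (ae_of_all _ (norm_Sfrak_le le_rfl)), fun K hK => ?_⟩
  obtain ⟨T, hT⟩ := hK.isBounded.exists_norm_le
  refine ⟨(eLpNorm (fun x : ℝ => screwConst T * (1 + |x|) ^ (-(3 / 4) : ℝ)) 2 volume).toReal,
    fun t ht => ENNReal.toReal_mono (hdom T).eLpNorm_ne_top ?_⟩
  exact eLpNorm_mono_real (norm_Sfrak_le (hT t ht))
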